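/- Let τ > 0 and let p be a probability density on ℝ^d with mean 0 that is more log-concave than the Gaussian N(0, τ^{−1} I_d), with invertible covariance matrix A. Let v ∈ ℝ^d be a unit vector and set Δ = E_{X∼p}[ (Xᵀ A^{−1/2} v) · X Xᵀ ]. Then tr(Δ²) ≤ ( (4/τ) · tr( A Δ² ) )^{1/2}. -/

import Mathlib

open MeasureTheory Filter Matrix

noncomputable section

/-- Mass of a set under a density. -/
def setMass {d : ℕ} (p : EuclideanSpace ℝ (Fin d) → ℝ) (S : Set (EuclideanSpace ℝ (Fin d))) : ℝ :=
  ∫ x in S, p x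

/-- `p` is a log-concave probability density on `ℝ^d`. -/
def IsLogConcaveDensity {d : ℕ} (p : EuclideanSpace ℝ (Fin d) → ℝ) : Prop :=
  (∀ x, 0 ≤ p x) ∧ (∫ x, p x = 1) ∧
    ∀ x y : EuclideanSpace ℝ (Fin d), ∀ t : ℝ, t ∈ Set.Icc (0:ℝ) 1 →
      p (t • x + (1 - t) • y) ≥ p x ^ t * p y ^ (1 - t)

/-- Boundary measure `p⁺(∂S)`. -/
def boundaryMeasure {d : ℕ} (p : EuclideanSpace ℝ (Fin d) → ℝ)
    (S : Set (EuclideanSpace ℝ (Fin d))) : ℝ :=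
  Filter.liminf
    (fun ε : ℝ => (setMass p {x | Metric.infDist x S ≤ ε} - setMass p S) / ε)
    (nhdsWithin 0 (Set.Ioi 0))

/-- Isoperimetric coefficient. -/
def isoperiCoeff {d : ℕ} (p : EuclideanSpace ℝ (Fin d) → ℝ) : ℝ :=
  sInf { r | ∃ S : Set (EuclideanSpace ℝ (Fin d)), MeasurableSet S ∧
    0 < setMass p S ∧ setMass p S < 1 ∧
    r = boundaryMeasure p S / min (setMass p S) (setMass p Sᶜ) }

/-- Mean of a density. -/
def densMean {d : ℕ} (p : EuclideanSpace ℝ (Fin d) → ℝ) : EuclideanSpace ℝ (Fin d) :=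
  ∫ x, p x • x

/-- Covariance matrix of a density. -/
def covMatrix {d : ℕ} (p : EuclideanSpace ℝ (Fin d) → ℝ) : Matrix (Fin d) (Fin d) ℝ :=
  Matrix.of fun i j => ∫ x, p x * ((x i - densMean p i) * (x j - densMean p j))

/-- Spectral norm of a matrix. -/
def specNorm {d : ℕ} (A : Matrix (Fin d) (Fin d) ℝ) : ℝ :=
  ‖Matrix.toEuclideanCLM (𝕜 := ℝ) A‖

/-- The KLS infimum constant over dimension `k`. -/
def psiDim (k : ℕ) : ℝ :=
  sInf { r | ∃ p : EuclideanSpace ℝ (Fin k) → ℝ, IsLogConcaveDensity p ∧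
    HasCompactSupport p ∧ r = isoperiCoeff p * Real.sqrt (specNorm (covMatrix p)) }

/-- Real power of a symmetric matrix through its spectral decomposition. -/
def matRpow {d : ℕ} (A : Matrix (Fin d) (Fin d) ℝ) (r : ℝ) : Matrix (Fin d) (Fin d) ℝ :=
  if hA : A.IsHermitian then
    (hA.eigenvectorUnitary : Matrix (Fin d) (Fin d) ℝ) *
      Matrix.diagonal (fun i => hA.eigenvalues i ^ r) *
      (star (hA.eigenvectorUnitary : Matrix (Fin d) (Fin d) ℝ))
  else 0

/-- The 3-tensor `T_p(A,B,C)` of a density. -/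
def ttensor {d : ℕ} (p : EuclideanSpace ℝ (Fin d) → ℝ)
    (A B C : Matrix (Fin d) (Fin d) ℝ) : ℝ :=
  ∫ x : EuclideanSpace ℝ (Fin d), ∫ y : EuclideanSpace ℝ (Fin d),
    p x * p y *
      (((fun i => x i - densMean p i) ⬝ᵥ A.mulVec (fun i => y i - densMean p i)) *
       ((fun i => x i - densMean p i) ⬝ᵥ B.mulVec (fun i => y i - densMean p i)) *
       ((fun i => x i - densMean p i) ⬝ᵥ C.mulVec (fun i => y i - densMean p i)))

/-- `p` is more log-concave than `N(0, τ⁻¹ I_d)`. -/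
def IsMoreLogConcaveThanGauss {d : ℕ} (τ : ℝ) (p : EuclideanSpace ℝ (Fin d) → ℝ) : Prop :=
  (∀ x, 0 ≤ p x) ∧ (∫ x, p x = 1) ∧
    ∀ x y : EuclideanSpace ℝ (Fin d), ∀ t : ℝ, t ∈ Set.Icc (0:ℝ) 1 →
      p (t • x + (1 - t) • y) * Real.exp (τ * ‖t • x + (1 - t) • y‖ ^ 2 / 2) ≥
        (p x * Real.exp (τ * ‖x‖ ^ 2 / 2)) ^ t *
        (p y * Real.exp (τ * ‖y‖ ^ 2 / 2)) ^ (1 - t)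

end

section PrekopaLeindler

open scoped ENNReal

/-- One-dimensional Brunn–Minkowski inequality for midpoints of compact sets. -/
theorem volume_add_volume_le_of_isCompact {K L C : Set ℝ} (hK : IsCompact K) (hL : IsCompact L)
    (hK0 : K.Nonempty) (hL0 : L.Nonempty)
    (h : ∀ x ∈ K, ∀ y ∈ L, (1 / 2 : ℝ) • (x + y) ∈ C) :
    volume K + volume L ≤ 2 * volume C := by
  obtain ⟨a, haK, ha⟩ := hK.exists_isGreatest hK0
  obtain ⟨b, hbL, hb⟩ := hL.exists_isLeast hL0
  have hC : volume ((fun x : ℝ => (1 / 2) * x) ⁻¹' C) = 2 * volume C := by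
    rw [Real.volume_preimage_mul_left (by norm_num)]
    norm_num
  have hdisj : AEDisjoint volume ((fun x => x + -b) ⁻¹' K) ((fun x => x + -a) ⁻¹' L) := by
    refine measure_mono_null (t := {a + b}) ?_ Real.volume_singleton
    rintro z ⟨hz1, hz2⟩
    have h1 := ha hz1
    have h2 := hb hz2
    rw [Set.mem_singleton_iff]
    linarith
  have hLm : NullMeasurableSet ((fun x => x + -a) ⁻¹' L) :=
    ((measurable_id.add_const (-a)) hL.measurableSet).nullMeasurableSet
  rw [← hC, ← measure_preimage_add_right volume (-b) K, ← measure_preimage_add_right volume (-a) L,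
    ← measure_union₀ hLm hdisj]
  refine measure_mono ?_
  rintro z (hz | hz)
  · simpa using h _ hz b hbL
  · simpa using h a haK _ hz

theorem volume_add_volume_le_of_measurableSet {A B C : Set ℝ} (hA : MeasurableSet A)
    (hB : MeasurableSet B) (hA0 : A.Nonempty) (hB0 : B.Nonempty)
    (h : ∀ x ∈ A, ∀ y ∈ B, (1 / 2 : ℝ) • (x + y) ∈ C) :
    volume A + volume B ≤ 2 * volume C := by
  obtain ⟨a, ha⟩ := hA0
  obtain ⟨b, hb⟩ := hB0
  rw [hA.measure_eq_iSup_isCompact, hB.measure_eq_iSup_isCompact]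
  simp only [iSup_and']
  refine ENNReal.biSup_add_biSup_le' ⟨∅, Set.empty_subset _, isCompact_empty⟩
    ⟨∅, Set.empty_subset _, isCompact_empty⟩ ?_
  rintro K ⟨hKA, hK⟩ L ⟨hLB, hL⟩
  calc volume K + volume L ≤ volume (insert a K) + volume (insert b L) := by
        gcongr <;> exact Set.subset_insert _ _
    _ ≤ 2 * volume C := volume_add_volume_le_of_isCompact (hK.insert a) (hL.insert b)
        (Set.insert_nonempty _ _) (Set.insert_nonempty _ _) fun x hx y hy =>
          h x (Set.insert_subset ha hKA hx) y (Set.insert_subset hb hLB hy)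

theorem lintegral_add_lintegral_le_of_normalized {f g h : ℝ → ℝ} (hf : Measurable f)
    (hg : Measurable g) (hh : Measurable h) (hf0 : ∀ x, 0 ≤ f x) (hg0 : ∀ x, 0 ≤ g x)
    (hh0 : ∀ x, 0 ≤ h x) (hf1 : ∀ x, f x ≤ 1) (hg1 : ∀ x, g x ≤ 1)
    (hfs : ∀ t < 1, ∃ x, t < f x) (hgs : ∀ t < 1, ∃ x, t < g x)
    (hfg : ∀ x y, f x * g y ≤ h ((1 / 2 : ℝ) • (x + y)) ^ 2) :
    (∫⁻ x, ENNReal.ofReal (f x)) + ∫⁻ x, ENNReal.ofReal (g x) ≤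
      2 * ∫⁻ x, ENNReal.ofReal (h x) := by
  have hmeas : ∀ k : ℝ → ℝ, Measurable fun t => volume {a | t < k a} := fun k =>
    Antitone.measurable fun s t hst => measure_mono fun x (hx : t < k x) => lt_of_le_of_lt hst hx
  rw [lintegral_eq_lintegral_meas_lt volume (ae_of_all _ hf0) hf.aemeasurable,
    lintegral_eq_lintegral_meas_lt volume (ae_of_all _ hg0) hg.aemeasurable,
    lintegral_eq_lintegral_meas_lt volume (ae_of_all _ hh0) hh.aemeasurable,
    ← lintegral_add_left (hmeas f), ← lintegral_const_mul _ (hmeas h)]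
  refine setLIntegral_mono ((hmeas h).const_mul 2) fun t ht => ?_
  have ht0 : (0 : ℝ) < t := ht
  rcases lt_or_ge t 1 with ht1 | ht1
  · refine volume_add_volume_le_of_measurableSet (measurableSet_lt measurable_const hf)
      (measurableSet_lt measurable_const hg) (hfs t ht1) (hgs t ht1) fun x hx y hy => ?_
    have hx' : t < f x := hx
    have hy' : t < g y := hy
    refine lt_of_pow_lt_pow_left₀ 2 (hh0 _) ((?_ : t ^ 2 < f x * g y).trans_le (hfg x y))
    nlinarith
  · have e1 : {a | t < f a} = ∅ := Set.eq_empty_of_forall_notMem fun x hx =>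
      absurd (hf1 x) (not_le.2 (ht1.trans_lt hx))
    have e2 : {a | t < g a} = ∅ := Set.eq_empty_of_forall_notMem fun x hx =>
      absurd (hg1 x) (not_le.2 (ht1.trans_lt hx))
    simp [e1, e2]

theorem ENNReal.mul_le_sq_of_add_le_two_mul {a b c : ℝ≥0∞} (h : a + b ≤ 2 * c) :
    a * b ≤ c ^ 2 := by
  rcases eq_or_ne c ⊤ with rfl | hc
  · simp
  have hab : a + b ≠ ⊤ := ne_top_of_le_ne_top (ENNReal.mul_ne_top (by simp) hc) h
  have ha : a ≠ ⊤ := ne_top_of_le_ne_top hab le_self_add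
  have hb : b ≠ ⊤ := ne_top_of_le_ne_top hab le_add_self
  lift a to NNReal using ha
  lift b to NNReal using hb
  lift c to NNReal using hc
  norm_cast at h ⊢
  rw [← NNReal.coe_le_coe] at h ⊢
  push_cast at h ⊢
  nlinarith [sq_nonneg ((a : ℝ) - b), a.2, b.2, c.2, a.coe_nonneg, b.coe_nonneg]

/-- The Prékopa–Leindler inequality with parameter `1 / 2` holds on `E`. -/
def MidpointPrekopaLeindler (E : Type*) [MeasureSpace E] [Add E] [SMul ℝ E] : Prop :=
  ∀ F G H : E → ℝ≥0∞, Measurable F → Measurable G → Measurable H →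
    (∀ x y, F x * G y ≤ H ((1 / 2 : ℝ) • (x + y)) ^ 2) →
    (∫⁻ x, F x) * (∫⁻ x, G x) ≤ (∫⁻ x, H x) ^ 2

theorem lintegral_mul_lintegral_le_of_bounded {F G H : ℝ → ℝ≥0∞} (hF : Measurable F)
    (hG : Measurable G) (hH : Measurable H) {m n : ℝ≥0∞} (hm : m ≠ ⊤) (hn : n ≠ ⊤)
    (hFm : ∀ x, F x ≤ m) (hGn : ∀ x, G x ≤ n)
    (hFG : ∀ x y, F x * G y ≤ H ((1 / 2 : ℝ) • (x + y)) ^ 2) :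
    (∫⁻ x, F x) * (∫⁻ x, G x) ≤ (∫⁻ x, H x) ^ 2 := by
  set a := ⨆ x, F x with ha
  set b := ⨆ x, G x with hb
  have haF : ∀ x, F x ≤ a := le_iSup F
  have hbG : ∀ x, G x ≤ b := le_iSup G
  have ha_top : a ≠ ⊤ := ne_top_of_le_ne_top hm (iSup_le hFm)
  have hb_top : b ≠ ⊤ := ne_top_of_le_ne_top hn (iSup_le hGn)
  rcases eq_or_ne a 0 with ha0 | ha0
  · have : ∀ x, F x = 0 := fun x => le_antisymm (ha0 ▸ haF x) bot_le
    simp [this]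
  rcases eq_or_ne b 0 with hb0 | hb0
  · have : ∀ x, G x = 0 := fun x => le_antisymm (hb0 ▸ hbG x) bot_le
    simp [this]
  obtain ⟨c, hc⟩ : ∃ c : ℝ≥0∞, c ^ 2 = a * b := ⟨(a * b) ^ (1 / 2 : ℝ), by
    rw [← ENNReal.rpow_natCast, ← ENNReal.rpow_mul]; norm_num⟩
  have hab0 : a * b ≠ 0 := mul_ne_zero ha0 hb0
  have hab_top : a * b ≠ ⊤ := ENNReal.mul_ne_top ha_top hb_top
  have hc0 : c ≠ 0 := by rintro rfl; exact hab0 (by simpa using hc.symm)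
  have hc_top : c ≠ ⊤ := by rintro rfl; exact hab_top (by simpa using hc.symm)
  have hFa : ∀ x, F x / a ≤ 1 := fun x => ENNReal.div_le_of_le_mul (by simpa using haF x)
  have hGb : ∀ x, G x / b ≤ 1 := fun x => ENNReal.div_le_of_le_mul (by simpa using hbG x)
  have hFt : ∀ x, F x / a ≠ ⊤ := fun x => ne_top_of_le_ne_top ENNReal.one_ne_top (hFa x)
  have hGt : ∀ x, G x / b ≠ ⊤ := fun x => ne_top_of_le_ne_top ENNReal.one_ne_top (hGb x)
  have hHt : ∀ x, min (H x / c) 1 ≠ ⊤ := fun x =>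
    ne_top_of_le_ne_top ENNReal.one_ne_top (min_le_right _ _)
  have hsup : ∀ (K : ℝ → ℝ≥0∞) (k : ℝ≥0∞), k = ⨆ x, K x → k ≠ 0 → k ≠ ⊤ →
      (∀ x, K x / k ≠ ⊤) → ∀ t < (1 : ℝ), ∃ x, t < (K x / k).toReal := by
    intro K k hk hk0 hkt hKt t ht
    have h1 : ENNReal.ofReal t * k < k := by
      conv_rhs => rw [← one_mul k]
      exact (ENNReal.mul_lt_mul_iff_left hk0 hkt).2 (by simpa using ht)
    rw [hk] at h1
    obtain ⟨x, hx⟩ := lt_iSup_iff.1 h1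
    rw [← hk] at hx
    refine ⟨x, ?_⟩
    have h2 : ENNReal.ofReal t < K x / k :=
      (ENNReal.lt_div_iff_mul_lt (Or.inl hk0) (Or.inl hkt)).2 hx
    by_contra! hle
    exact h2.not_ge (ENNReal.ofReal_toReal (hKt x) ▸ ENNReal.ofReal_le_ofReal hle)
  have hinv : ∀ u w : ℝ≥0∞, u / a * (w / b) = u * w * (a * b)⁻¹ := fun u w => by
    rw [ENNReal.mul_inv (Or.inl ha0) (Or.inl ha_top), div_eq_mul_inv, div_eq_mul_inv]
    ring
  have hdiv : ∀ u : ℝ≥0∞, (u / c) ^ 2 = u ^ 2 * (a * b)⁻¹ := fun u => by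
    rw [div_eq_mul_inv, mul_pow, ← ENNReal.inv_pow, hc]
  have key := lintegral_add_lintegral_le_of_normalized (f := fun x => (F x / a).toReal)
    (g := fun x => (G x / b).toReal) (h := fun x => (min (H x / c) 1).toReal)
    (hF.div_const a).ennreal_toReal (hG.div_const b).ennreal_toReal
    ((hH.div_const c).min measurable_const).ennreal_toReal
    (fun _ => ENNReal.toReal_nonneg) (fun _ => ENNReal.toReal_nonneg)
    (fun _ => ENNReal.toReal_nonneg)
    (fun x => ENNReal.toReal_le_of_le_ofReal zero_le_one (by simpa using hFa x))
    (fun x => ENNReal.toReal_le_of_le_ofReal zero_le_one (by simpa using hGb x))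
    (hsup F a ha ha0 ha_top hFt) (hsup G b hb hb0 hb_top hGt) (by
      intro x y
      rw [← ENNReal.toReal_mul, ← ENNReal.toReal_pow]
      refine ENNReal.toReal_mono (ENNReal.pow_ne_top (hHt _)) ?_
      rcases le_total (H ((1 / 2 : ℝ) • (x + y)) / c) 1 with hle | hle
      · rw [min_eq_left hle, hdiv, hinv]
        exact mul_le_mul_left (hFG x y) _
      · rw [min_eq_right hle, one_pow]
        exact mul_le_one' (hFa x) (hGb y))
  simp only [ENNReal.ofReal_toReal (hFt _), ENNReal.ofReal_toReal (hGt _),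
    ENNReal.ofReal_toReal (hHt _)] at key
  have hH' : ∫⁻ x, min (H x / c) 1 ≤ (∫⁻ x, H x) / c := by
    calc ∫⁻ x, min (H x / c) 1 ≤ ∫⁻ x, H x / c := lintegral_mono fun x => min_le_left _ _
      _ = (∫⁻ x, H x) / c := by simp only [div_eq_mul_inv, lintegral_mul_const _ hH]
  have key2 : (∫⁻ x, F x) / a * ((∫⁻ x, G x) / b) ≤ ((∫⁻ x, H x) / c) ^ 2 := by
    refine le_trans ?_ (pow_le_pow_left₀ zero_le hH' 2)
    simpa only [div_eq_mul_inv, lintegral_mul_const _ hF, lintegral_mul_const _ hG] using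
      ENNReal.mul_le_sq_of_add_le_two_mul key
  rw [hinv, hdiv] at key2
  exact (ENNReal.mul_le_mul_iff_left (ENNReal.inv_ne_zero.2 hab_top)
    (ENNReal.inv_ne_top.2 hab0)).1 key2

theorem midpointPrekopaLeindler_real : MidpointPrekopaLeindler ℝ := by
  intro F G H hF hG hH hFG
  have hsup : ∀ K : ℝ → ℝ≥0∞, Measurable K →
      ∫⁻ x, K x = ⨆ n : ℕ, ∫⁻ x, min (K x) n := by
    intro K hK
    rw [← lintegral_iSup (fun n => hK.min measurable_const)]
    · refine lintegral_congr fun x => ?_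
      rw [← inf_iSup_eq, ENNReal.iSup_natCast, inf_top_eq]
    · intro m n hmn x
      exact min_le_min le_rfl (by exact_mod_cast hmn)
  rw [hsup F hF, hsup G hG, ENNReal.iSup_mul]
  refine iSup_le fun m => ?_
  rw [ENNReal.mul_iSup]
  refine iSup_le fun n => ?_
  exact lintegral_mul_lintegral_le_of_bounded (hF.min measurable_const) (hG.min measurable_const)
    hH (ENNReal.natCast_ne_top m) (ENNReal.natCast_ne_top n) (fun _ => min_le_right _ _)
    (fun _ => min_le_right _ _)
    fun x y => (mul_le_mul' (min_le_left _ _) (min_le_left _ _)).trans (hFG x y)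

theorem MidpointPrekopaLeindler.prod {E E' : Type*} [MeasureSpace E] [Add E] [SMul ℝ E]
    [MeasureSpace E'] [Add E'] [SMul ℝ E'] [SFinite (volume : Measure E')]
    (hE : MidpointPrekopaLeindler E) (hE' : MidpointPrekopaLeindler E') :
    MidpointPrekopaLeindler (E × E') := by
  intro F G H hF hG hH hFG
  rw [Measure.volume_eq_prod, lintegral_prod _ hF.aemeasurable, lintegral_prod _ hG.aemeasurable,
    lintegral_prod _ hH.aemeasurable]
  refine hE _ _ _ hF.lintegral_prod_right' hG.lintegral_prod_right' hH.lintegral_prod_right' ?_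
  intro x y
  exact hE' _ _ _ (hF.comp measurable_prodMk_left) (hG.comp measurable_prodMk_left)
    (hH.comp measurable_prodMk_left) fun x' y' => hFG (x, x') (y, y')

theorem MidpointPrekopaLeindler.of_measurePreserving {E E' : Type*} [MeasureSpace E] [Add E]
    [SMul ℝ E] [MeasureSpace E'] [Add E'] [SMul ℝ E'] (hE : MidpointPrekopaLeindler E)
    (φ : E → E') (hφ : MeasurePreserving φ)
    (hadd : ∀ x y, φ ((1 / 2 : ℝ) • (x + y)) = (1 / 2 : ℝ) • (φ x + φ y)) :
    MidpointPrekopaLeindler E' := by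
  intro F G H hF hG hH hFG
  rw [← hφ.lintegral_comp hF, ← hφ.lintegral_comp hG, ← hφ.lintegral_comp hH]
  refine hE _ _ _ (hF.comp hφ.measurable) (hG.comp hφ.measurable) (hH.comp hφ.measurable) ?_
  intro x y
  simpa only [Function.comp_apply, hadd] using hFG (φ x) (φ y)

theorem midpointPrekopaLeindler_pi (n : ℕ) : MidpointPrekopaLeindler (Fin n → ℝ) := by
  induction n with
  | zero =>
    intro F G H hF hG hH hFG
    simp only [lintegral_unique, volume_pi, Measure.pi_univ, Finset.univ_eq_empty,
      Finset.prod_empty, mul_one]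
    exact (hFG _ _).trans_eq (congrArg (fun z => H z ^ 2) (Subsingleton.elim _ _))
  | succ n ih =>
    refine (midpointPrekopaLeindler_real.prod ih).of_measurePreserving
      (MeasurableEquiv.piFinSuccAbove (fun _ => ℝ) 0).symm
      (volume_preserving_piFinSuccAbove (fun _ : Fin (n + 1) => ℝ) 0).symm fun x y => ?_
    ext i
    refine Fin.cases ?_ (fun j => ?_) i <;> simp [MeasurableEquiv.piFinSuccAbove, mul_add]

/-- The Prékopa–Leindler inequality with parameter `1 / 2` on Euclidean space. -/
theorem midpointPrekopaLeindler_euclideanSpace (d : ℕ) :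
    MidpointPrekopaLeindler (EuclideanSpace ℝ (Fin d)) :=
  (midpointPrekopaLeindler_pi d).of_measurePreserving (WithLp.toLp 2)
    (PiLp.volume_preserving_toLp (Fin d)) fun _ _ => rfl

theorem MidpointPrekopaLeindler.lintegral_mul_lintegral_le {E : Type*} [MeasureSpace E] [Add E]
    [SMul ℝ E] (hE : MidpointPrekopaLeindler E) {F G H : E → ℝ≥0∞} (hH : AEMeasurable H)
    (hFG : ∀ x y, F x * G y ≤ H ((1 / 2 : ℝ) • (x + y)) ^ 2) :
    (∫⁻ x, F x) * (∫⁻ x, G x) ≤ (∫⁻ x, H x) ^ 2 := by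
  classical
  obtain ⟨F', hF', hF'F, hF'eq⟩ := exists_measurable_le_lintegral_eq (μ := volume) F
  obtain ⟨G', hG', hG'G, hG'eq⟩ := exists_measurable_le_lintegral_eq (μ := volume) G
  obtain ⟨t, ht, htm, ht0⟩ := exists_measurable_superset_of_null (ae_iff.1 hH.ae_eq_mk)
  have hle : ∀ x, H x ≤ t.piecewise (fun _ => ⊤) (hH.mk H) x := fun x => by
    by_cases hx : x ∈ t
    · simp [hx]
    · have : H x = hH.mk H x := not_not.1 fun h => hx (ht h)
      simp [hx, this]
  have heq : ∫⁻ x, H x = ∫⁻ x, t.piecewise (fun _ => ⊤) (hH.mk H) x := by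
    refine lintegral_congr_ae ?_
    filter_upwards [measure_eq_zero_iff_ae_notMem.1 ht0] with x hx
    have : H x = hH.mk H x := not_not.1 fun h => hx (ht h)
    simp [hx, this]
  rw [hF'eq, hG'eq, heq]
  refine hE F' G' _ hF' hG' (measurable_const.piecewise htm hH.measurable_mk) fun x y => ?_
  exact ((mul_le_mul' (hF'F x) (hG'G y)).trans (hFG x y)).trans
    (pow_le_pow_left₀ zero_le (hle _) 2)

end PrekopaLeindler

section Poincare

open scoped RealInnerProductSpace

theorem half_norm_sub_sq_ge {E : Type*} [NormedAddCommGroup E] [InnerProductSpace ℝ E]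
    (T : E →L[ℝ] E) (hT : ∀ x y, ⟪T x, y⟫ = ⟪x, T y⟫) (x y : E) :
    (⟪x, T x⟫ - ‖T x‖ ^ 2) + (-⟪y, T y⟫ - ‖T y‖ ^ 2) ≤
      ‖x‖ ^ 2 + ‖y‖ ^ 2 - 2 * ‖(1 / 2 : ℝ) • (x + y)‖ ^ 2 := by
  have h1 := sq_nonneg ‖(x - y) - T (x + y)‖
  have h2 := sq_nonneg ‖T (x - y)‖
  have hxy : ⟪x, T y⟫ = ⟪y, T x⟫ := by rw [← hT, real_inner_comm]
  simp only [← real_inner_self_eq_norm_sq, map_add, map_sub, inner_add_left, inner_add_right,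
    inner_sub_left, inner_sub_right, inner_smul_left, inner_smul_right] at h1 h2 ⊢
  have hTT : ⟪x, T (T y)⟫ = ⟪y, T (T x)⟫ := by rw [← hT, ← hT, real_inner_comm]
  simp only [hT, RCLike.conj_to_real] at h1 h2 ⊢
  linarith [real_inner_comm x y]

theorem inner_apply_sub_norm_sq_le {E : Type*} [NormedAddCommGroup E] [InnerProductSpace ℝ E]
    (x y : E) : ⟪x, y⟫ - ‖y‖ ^ 2 ≤ ‖x‖ ^ 2 / 4 := by
  nlinarith [real_inner_le_norm x y, sq_nonneg (‖x‖ - 2 * ‖y‖)]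

theorem one_add_add_sq_sub_cube_le_exp (x : ℝ) : 1 + x + x ^ 2 / 2 - |x| ^ 3 ≤ Real.exp x := by
  rcases le_or_gt |x| 1 with h | h
  · have := Real.exp_bound h (n := 3) (by norm_num)
    norm_num [Finset.sum_range_succ, Nat.factorial] at this
    have h3 : 0 ≤ |x| ^ 3 := by positivity
    linarith [(abs_le.1 this).1]
  · have h2 : |x| ^ 2 = x ^ 2 := sq_abs x
    have := Real.exp_pos x
    rcases le_total 0 x with hx | hx
    · have h3 : 0 ≤ |x| ^ 3 := by positivity
      linarith [Real.quadratic_le_exp_of_nonneg hx]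
    · rw [abs_of_nonpos hx] at h ⊢
      nlinarith [sq_nonneg x, mul_nonneg (sq_nonneg x) (sub_nonneg.2 h.le)]

theorem expansion_le_exp {a c M s : ℝ} (ha : |a| ≤ M) (hc : |c| ≤ M) (hs : |s| ≤ 1) :
    1 + s * a + s ^ 2 * (a ^ 2 / 2 - c) - |s| ^ 3 * (M ^ 2 + 8 * M ^ 3) ≤
      Real.exp (s * a - s ^ 2 * c) := by
  have hM : 0 ≤ M := (abs_nonneg a).trans ha
  have hs0 := abs_nonneg s
  have h1 : |s * a - s ^ 2 * c| ≤ |s| * (2 * M) := by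
    calc |s * a - s ^ 2 * c| ≤ |s * a| + |s ^ 2 * c| := abs_sub _ _
      _ = |s| * |a| + |s| * (|s| * |c|) := by rw [abs_mul, abs_mul, abs_pow]; ring
      _ ≤ |s| * M + |s| * (1 * M) := by gcongr
      _ = |s| * (2 * M) := by ring
  have h2 : |s * a - s ^ 2 * c| ^ 3 ≤ |s| ^ 3 * (8 * M ^ 3) := by
    calc _ ≤ (|s| * (2 * M)) ^ 3 := by gcongr
      _ = _ := by ring
  have h3 : s ^ 3 * (a * c) ≤ |s| ^ 3 * M ^ 2 := by
    calc s ^ 3 * (a * c) ≤ |s ^ 3 * (a * c)| := le_abs_self _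
      _ = |s| ^ 3 * (|a| * |c|) := by rw [abs_mul, abs_mul, abs_pow]
      _ ≤ |s| ^ 3 * (M * M) := by gcongr
      _ = _ := by ring
  have h4 : 0 ≤ s ^ 4 * c ^ 2 := by positivity
  linarith [one_add_add_sq_sub_cube_le_exp (s * a - s ^ 2 * c)]

theorem two_mul_le_sq_of_expansion {Z : ℝ → ℝ} {α β w : ℝ}
    (hZ : ∀ s, |s| ≤ 1 → 1 + s * α + s ^ 2 * β - |s| ^ 3 * w ≤ Z s)
    (hmul : ∀ s, Z s * Z (-s) ≤ 1) : 2 * β ≤ α ^ 2 := by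
  by_contra! hlt
  have hlim : ∀ f : ℝ → ℝ, Continuous f → 0 < f 0 →
      ∀ᶠ s in nhdsWithin 0 (Set.Ioi (0 : ℝ)), 0 < f s :=
    fun f hf h0 => (hf.continuousAt.eventually (lt_mem_nhds h0)).filter_mono nhdsWithin_le_nhds
  have h1 := hlim (fun s => 1 + s * α + s ^ 2 * β - s ^ 3 * w) (by fun_prop) (by norm_num)
  have h2 := hlim (fun s => 1 - s * α + s ^ 2 * β - s ^ 3 * w) (by fun_prop) (by norm_num)
  have h3 := hlim (fun s => 2 * β - α ^ 2 - 2 * s * w) (by fun_prop) (by simpa using hlt)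
  have h4 := hlim (fun s => 1 - s) (by fun_prop) (by norm_num)
  obtain ⟨s, h1, h2, h3, h4, hs⟩ :=
    (h1.and (h2.and (h3.and (h4.and self_mem_nhdsWithin)))).exists
  have hs0 : 0 < s := hs
  have ha : |s| = s := abs_of_pos hs0
  have hp := hZ s (by linarith)
  have hm := hZ (-s) (by rw [abs_neg]; linarith)
  rw [abs_neg, ha] at hm
  rw [ha] at hp
  have hmul' : (1 + s * α + s ^ 2 * β - s ^ 3 * w) * (1 - s * α + s ^ 2 * β - s ^ 3 * w) ≤ 1 :=
    (mul_le_mul hp (by linarith) h2.le (h1.le.trans hp)).trans (hmul s)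
  nlinarith [mul_pos (pow_pos hs0 2) h3, sq_nonneg (s ^ 2 * β - s ^ 3 * w)]

namespace IsMoreLogConcaveThanGauss

variable {d : ℕ} {τ : ℝ} {p : EuclideanSpace ℝ (Fin d) → ℝ}

theorem integrable (hp : IsMoreLogConcaveThanGauss τ p) : Integrable p :=
  integrable_of_integral_eq_one hp.2.1

theorem mul_le_sq (hp : IsMoreLogConcaveThanGauss τ p) (x y : EuclideanSpace ℝ (Fin d)) :
    p x * p y * Real.exp (τ / 2 * (‖x‖ ^ 2 + ‖y‖ ^ 2 - 2 * ‖(1 / 2 : ℝ) • (x + y)‖ ^ 2)) ≤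
      p ((1 / 2 : ℝ) • (x + y)) ^ 2 := by
  have h := hp.2.2 x y (1 / 2) ⟨by norm_num, by norm_num⟩
  rw [show (1 - 1 / 2 : ℝ) = 1 / 2 by norm_num, ← smul_add] at h
  set m := (1 / 2 : ℝ) • (x + y)
  have hx := mul_nonneg (hp.1 x) (Real.exp_nonneg (τ * ‖x‖ ^ 2 / 2))
  have hy := mul_nonneg (hp.1 y) (Real.exp_nonneg (τ * ‖y‖ ^ 2 / 2))
  rw [← Real.sqrt_eq_rpow, ← Real.sqrt_eq_rpow, ← Real.sqrt_mul hx, ge_iff_le] at h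
  have h2 := (Real.sqrt_le_left (mul_nonneg (hp.1 m) (Real.exp_nonneg _))).1 h
  have e : τ / 2 * (‖x‖ ^ 2 + ‖y‖ ^ 2 - 2 * ‖m‖ ^ 2) =
    τ * ‖x‖ ^ 2 / 2 + τ * ‖y‖ ^ 2 / 2 + -(τ * ‖m‖ ^ 2 / 2) + -(τ * ‖m‖ ^ 2 / 2) := by ring
  rw [e, Real.exp_add, Real.exp_add, Real.exp_add, Real.exp_neg]
  have hpos := Real.exp_pos (τ * ‖m‖ ^ 2 / 2)
  rw [← mul_assoc, ← mul_assoc, ← div_eq_mul_inv, ← div_eq_mul_inv, div_div,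
    div_le_iff₀ (by positivity)]
  linarith

theorem lintegral_mul_lintegral_le_one (hp : IsMoreLogConcaveThanGauss τ p) (hτ : 0 < τ)
    (T : EuclideanSpace ℝ (Fin d) →L[ℝ] EuclideanSpace ℝ (Fin d))
    (hT : ∀ x y, ⟪T x, y⟫ = ⟪x, T y⟫) :
    (∫⁻ x, ENNReal.ofReal (p x * Real.exp (τ / 2 * (⟪x, T x⟫ - ‖T x‖ ^ 2)))) *
      (∫⁻ x, ENNReal.ofReal (p x * Real.exp (τ / 2 * (-⟪x, T x⟫ - ‖T x‖ ^ 2)))) ≤ 1 := by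
  have h1 : ∫⁻ x, ENNReal.ofReal (p x) = 1 := by
    rw [← ofReal_integral_eq_lintegral_ofReal hp.integrable (ae_of_all _ hp.1), hp.2.1,
      ENNReal.ofReal_one]
  rw [show (1 : ENNReal) = (∫⁻ x, ENNReal.ofReal (p x)) ^ 2 by rw [h1, one_pow]]
  refine (midpointPrekopaLeindler_euclideanSpace d).lintegral_mul_lintegral_le
    hp.integrable.aemeasurable.ennreal_ofReal fun x y => ?_
  rw [← ENNReal.ofReal_mul (mul_nonneg (hp.1 x) (Real.exp_nonneg _)),
    ← ENNReal.ofReal_pow (hp.1 _)]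
  refine ENNReal.ofReal_le_ofReal (le_trans ?_ (hp.mul_le_sq x y))
  rw [mul_mul_mul_comm, ← Real.exp_add, ← mul_add]
  gcongr
  · exact mul_nonneg (hp.1 x) (hp.1 y)
  · exact half_norm_sub_sq_ge T hT x y

theorem integrable_mul_exp (hp : IsMoreLogConcaveThanGauss τ p) (hτ : 0 < τ) :
    Integrable fun x => p x * Real.exp (τ / 8 * ‖x‖ ^ 2) := by
  have h := hp.lintegral_mul_lintegral_le_one hτ
    ((1 / 2 : ℝ) • ContinuousLinearMap.id ℝ (EuclideanSpace ℝ (Fin d))) (fun x y => by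
      simp [inner_smul_left, inner_smul_right])
  have hmeas : ∀ f : EuclideanSpace ℝ (Fin d) → ℝ, Continuous f →
      AEStronglyMeasurable (fun x => p x * Real.exp (f x)) := fun f hf =>
    hp.integrable.aestronglyMeasurable.mul (Real.continuous_exp.comp hf).aestronglyMeasurable
  refine ⟨hmeas _ (by fun_prop), ?_⟩
  rw [hasFiniteIntegral_iff_ofReal (ae_of_all _ fun x => mul_nonneg (hp.1 x) (Real.exp_nonneg _))]
  refine lt_top_iff_ne_top.2 fun htop => ?_
  have e : ∀ x : EuclideanSpace ℝ (Fin d), τ / 2 * (⟪x, ((1 / 2 : ℝ) •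
      ContinuousLinearMap.id ℝ (EuclideanSpace ℝ (Fin d))) x⟫ - ‖((1 / 2 : ℝ) •
      ContinuousLinearMap.id ℝ (EuclideanSpace ℝ (Fin d))) x‖ ^ 2) = τ / 8 * ‖x‖ ^ 2 := fun x => by
    simp [inner_smul_right, norm_smul]
    ring
  simp only [e, htop] at h
  have h0 : (∫⁻ x, ENNReal.ofReal (p x * Real.exp (τ / 2 * (-⟪x, ((1 / 2 : ℝ) •
      ContinuousLinearMap.id ℝ (EuclideanSpace ℝ (Fin d))) x⟫ - ‖((1 / 2 : ℝ) •
      ContinuousLinearMap.id ℝ (EuclideanSpace ℝ (Fin d))) x‖ ^ 2)))) = 0 := by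
    by_contra hne
    rw [ENNReal.top_mul hne] at h
    simp at h
  rw [lintegral_eq_zero_iff' (hmeas _ (by fun_prop)).aemeasurable.ennreal_ofReal] at h0
  have hp0 : p =ᵐ[volume] 0 := by
    filter_upwards [h0] with x hx
    have := ENNReal.ofReal_eq_zero.1 hx
    exact le_antisymm (nonpos_of_mul_nonpos_left this (Real.exp_pos _)) (hp.1 x)
  have := hp.2.1
  rw [integral_congr_ae hp0] at this
  simp at this

theorem integrable_mul_norm_pow (hp : IsMoreLogConcaveThanGauss τ p) (hτ : 0 < τ) (n : ℕ) :
    Integrable fun x => p x * ‖x‖ ^ n := by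
  refine ((hp.integrable_mul_exp hτ).const_mul (1 + n.factorial / (τ / 8) ^ n)).mono'
    (hp.integrable.aestronglyMeasurable.mul (by fun_prop)) (ae_of_all _ fun x => ?_)
  have hf := hp.1 x
  rw [Real.norm_of_nonneg (by positivity), mul_left_comm]
  refine mul_le_mul_of_nonneg_left ?_ hf
  have h1 := Real.pow_div_factorial_le_exp (τ / 8 * ‖x‖ ^ 2) (by positivity) n
  have h2 : (1 : ℝ) ≤ Real.exp (τ / 8 * ‖x‖ ^ 2) := Real.one_le_exp (by positivity)
  have h3 : ‖x‖ ^ n ≤ 1 + (‖x‖ ^ n) ^ 2 := by nlinarith [sq_nonneg (‖x‖ ^ n - 1)]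
  rw [mul_pow, div_le_iff₀ (by positivity)] at h1
  have h4 : (‖x‖ ^ n) ^ 2 ≤ n.factorial / (τ / 8) ^ n * Real.exp (τ / 8 * ‖x‖ ^ 2) := by
    rw [div_mul_eq_mul_div, le_div_iff₀ (by positivity), ← pow_mul, mul_comm n 2, pow_mul]
    linarith
  linarith

/-- Continuous functions of polynomial growth are integrable against `p`. -/
theorem integrable_mul (hp : IsMoreLogConcaveThanGauss τ p) (hτ : 0 < τ)
    {f : EuclideanSpace ℝ (Fin d) → ℝ} (hf : Continuous f) (C : ℝ) (n : ℕ)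
    (hC : ∀ x, |f x| ≤ C * ‖x‖ ^ n) : Integrable fun x => p x * f x := by
  refine ((hp.integrable_mul_norm_pow hτ n).const_mul C).mono'
    (hp.integrable.aestronglyMeasurable.mul hf.aestronglyMeasurable) (ae_of_all _ fun x => ?_)
  rw [norm_mul, Real.norm_of_nonneg (hp.1 x), Real.norm_eq_abs, mul_left_comm]
  exact mul_le_mul_of_nonneg_left (hC x) (hp.1 x)

theorem integrable_mul_exp_inner (hp : IsMoreLogConcaveThanGauss τ p) (hτ : 0 < τ)
    (T : EuclideanSpace ℝ (Fin d) →L[ℝ] EuclideanSpace ℝ (Fin d)) :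
    Integrable fun x => p x * Real.exp (τ / 2 * (⟪x, T x⟫ - ‖T x‖ ^ 2)) := by
  refine (hp.integrable_mul_exp hτ).mono' (hp.integrable.aestronglyMeasurable.mul
    (Continuous.aestronglyMeasurable (by fun_prop))) (ae_of_all _ fun x => ?_)
  rw [Real.norm_of_nonneg (mul_nonneg (hp.1 x) (Real.exp_nonneg _))]
  refine mul_le_mul_of_nonneg_left (Real.exp_le_exp.2 ?_) (hp.1 x)
  nlinarith [inner_apply_sub_norm_sq_le x (T x)]

theorem integral_mul_integral_le_one (hp : IsMoreLogConcaveThanGauss τ p) (hτ : 0 < τ)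
    (T : EuclideanSpace ℝ (Fin d) →L[ℝ] EuclideanSpace ℝ (Fin d))
    (hT : ∀ x y, ⟪T x, y⟫ = ⟪x, T y⟫) :
    (∫ x, p x * Real.exp (τ / 2 * (⟪x, T x⟫ - ‖T x‖ ^ 2))) *
      (∫ x, p x * Real.exp (τ / 2 * (⟪x, (-T) x⟫ - ‖(-T) x‖ ^ 2))) ≤ 1 := by
  have h := hp.lintegral_mul_lintegral_le_one hτ T hT
  have hnn : ∀ f : EuclideanSpace ℝ (Fin d) → ℝ, 0 ≤ᵐ[volume] fun x => p x * Real.exp (f x) :=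
    fun f => ae_of_all _ fun x => mul_nonneg (hp.1 x) (Real.exp_nonneg _)
  have e : ∀ x, -⟪x, T x⟫ - ‖T x‖ ^ 2 = ⟪x, (-T) x⟫ - ‖(-T) x‖ ^ 2 := fun x => by simp
  simp only [e] at h
  rw [← ofReal_integral_eq_lintegral_ofReal (hp.integrable_mul_exp_inner hτ T) (hnn _),
    ← ofReal_integral_eq_lintegral_ofReal (hp.integrable_mul_exp_inner hτ (-T)) (hnn _),
    ← ENNReal.ofReal_mul (integral_nonneg_of_ae (hnn _))] at h
  exact ENNReal.ofReal_le_one.1 h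

theorem abs_inner_apply_le (T : EuclideanSpace ℝ (Fin d) →L[ℝ] EuclideanSpace ℝ (Fin d))
    (x : EuclideanSpace ℝ (Fin d)) : |⟪x, T x⟫| ≤ ‖T‖ * ‖x‖ ^ 2 :=
  calc |⟪x, T x⟫| ≤ ‖x‖ * ‖T x‖ := abs_real_inner_le_norm _ _
    _ ≤ ‖x‖ * (‖T‖ * ‖x‖) := by gcongr; exact T.le_opNorm x
    _ = ‖T‖ * ‖x‖ ^ 2 := by ring

theorem norm_apply_sq_le (T : EuclideanSpace ℝ (Fin d) →L[ℝ] EuclideanSpace ℝ (Fin d))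
    (x : EuclideanSpace ℝ (Fin d)) : ‖T x‖ ^ 2 ≤ ‖T‖ ^ 2 * ‖x‖ ^ 2 := by
  rw [← mul_pow]
  gcongr
  exact T.le_opNorm x

theorem integrable_mul_inner (hp : IsMoreLogConcaveThanGauss τ p) (hτ : 0 < τ)
    (T : EuclideanSpace ℝ (Fin d) →L[ℝ] EuclideanSpace ℝ (Fin d)) :
    Integrable fun x => p x * ⟪x, T x⟫ :=
  hp.integrable_mul hτ (by fun_prop) ‖T‖ 2 (abs_inner_apply_le T)

theorem integrable_mul_inner_sq (hp : IsMoreLogConcaveThanGauss τ p) (hτ : 0 < τ)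
    (T : EuclideanSpace ℝ (Fin d) →L[ℝ] EuclideanSpace ℝ (Fin d)) :
    Integrable fun x => p x * ⟪x, T x⟫ ^ 2 := by
  refine hp.integrable_mul hτ (by fun_prop) (‖T‖ ^ 2) 4 fun x => ?_
  calc |⟪x, T x⟫ ^ 2| = |⟪x, T x⟫| ^ 2 := abs_pow _ _
    _ ≤ (‖T‖ * ‖x‖ ^ 2) ^ 2 := by gcongr; exact abs_inner_apply_le T x
    _ = ‖T‖ ^ 2 * ‖x‖ ^ 4 := by ring

theorem integrable_mul_norm_apply_sq (hp : IsMoreLogConcaveThanGauss τ p) (hτ : 0 < τ)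
    (T : EuclideanSpace ℝ (Fin d) →L[ℝ] EuclideanSpace ℝ (Fin d)) :
    Integrable fun x => p x * ‖T x‖ ^ 2 :=
  hp.integrable_mul hτ (by fun_prop) (‖T‖ ^ 2) 2 fun x => by
    rw [abs_of_nonneg (by positivity)]
    exact norm_apply_sq_le T x

/-- Poincaré inequality with constant `τ⁻¹` for the quadratic form `x ↦ ⟪x, T x⟫`. -/
theorem variance_inner_le (hp : IsMoreLogConcaveThanGauss τ p) (hτ : 0 < τ)
    (T : EuclideanSpace ℝ (Fin d) →L[ℝ] EuclideanSpace ℝ (Fin d))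
    (hT : ∀ x y, ⟪T x, y⟫ = ⟪x, T y⟫) :
    (∫ x, p x * ⟪x, T x⟫ ^ 2) - (∫ x, p x * ⟪x, T x⟫) ^ 2 ≤
      4 / τ * ∫ x, p x * ‖T x‖ ^ 2 := by
  set k := τ / 2 * (‖T‖ + ‖T‖ ^ 2) with hk
  have hk0 : 0 ≤ k := by positivity
  have hq := hp.integrable_mul_inner hτ T
  have hq2 := hp.integrable_mul_inner_sq hτ T
  have hr := hp.integrable_mul_norm_apply_sq hτ T
  have h4 := hp.integrable_mul_norm_pow hτ 4
  have h6 := hp.integrable_mul_norm_pow hτ 6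
  have hmain := two_mul_le_sq_of_expansion
    (Z := fun s => ∫ x, p x * Real.exp (τ / 2 * (⟪x, (s • T) x⟫ - ‖(s • T) x‖ ^ 2)))
    (α := τ / 2 * ∫ x, p x * ⟪x, T x⟫)
    (β := τ ^ 2 / 8 * (∫ x, p x * ⟪x, T x⟫ ^ 2) - τ / 2 * ∫ x, p x * ‖T x‖ ^ 2)
    (w := k ^ 2 * (∫ x, p x * ‖x‖ ^ 4) + 8 * k ^ 3 * ∫ x, p x * ‖x‖ ^ 6)
    (by
      intro s hs
      have i1 : Integrable fun x => p x + s * (τ / 2) * (p x * ⟪x, T x⟫) :=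
        hp.integrable.add (hq.const_mul _)
      have i2 : Integrable fun x => p x + s * (τ / 2) * (p x * ⟪x, T x⟫)
          + s ^ 2 * (τ ^ 2 / 8) * (p x * ⟪x, T x⟫ ^ 2) := i1.add (hq2.const_mul _)
      have i3 : Integrable fun x => p x + s * (τ / 2) * (p x * ⟪x, T x⟫)
          + s ^ 2 * (τ ^ 2 / 8) * (p x * ⟪x, T x⟫ ^ 2)
          - s ^ 2 * (τ / 2) * (p x * ‖T x‖ ^ 2) := i2.sub (hr.const_mul _)
      have i4 : Integrable fun x => p x + s * (τ / 2) * (p x * ⟪x, T x⟫)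
          + s ^ 2 * (τ ^ 2 / 8) * (p x * ⟪x, T x⟫ ^ 2) - s ^ 2 * (τ / 2) * (p x * ‖T x‖ ^ 2)
          - |s| ^ 3 * k ^ 2 * (p x * ‖x‖ ^ 4) := i3.sub (h4.const_mul _)
      have hint : ∫ x, (p x + s * (τ / 2) * (p x * ⟪x, T x⟫)
          + s ^ 2 * (τ ^ 2 / 8) * (p x * ⟪x, T x⟫ ^ 2) - s ^ 2 * (τ / 2) * (p x * ‖T x‖ ^ 2)
          - |s| ^ 3 * k ^ 2 * (p x * ‖x‖ ^ 4) - |s| ^ 3 * (8 * k ^ 3) * (p x * ‖x‖ ^ 6)) ≤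
          ∫ x, p x * Real.exp (τ / 2 * (⟪x, (s • T) x⟫ - ‖(s • T) x‖ ^ 2)) := by
        refine integral_mono (i4.sub (h6.const_mul _))
          (hp.integrable_mul_exp_inner hτ (s • T)) fun x => ?_
        have hx2 : 0 ≤ ‖x‖ ^ 2 := by positivity
        have e := expansion_le_exp (a := τ / 2 * ⟪x, T x⟫) (c := τ / 2 * ‖T x‖ ^ 2)
          (M := k * ‖x‖ ^ 2) (s := s) (by
            rw [abs_mul, abs_of_pos (half_pos hτ), hk, mul_assoc]
            gcongr
            refine (abs_inner_apply_le T x).trans ?_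
            gcongr
            exact le_add_of_nonneg_right (sq_nonneg _)) (by
            rw [abs_of_nonneg (by positivity), hk, mul_assoc]
            gcongr
            refine (norm_apply_sq_le T x).trans ?_
            gcongr
            exact le_add_of_nonneg_left (norm_nonneg _)) hs
        have e2 : τ / 2 * (⟪x, (s • T) x⟫ - ‖(s • T) x‖ ^ 2) =
            s * (τ / 2 * ⟪x, T x⟫) - s ^ 2 * (τ / 2 * ‖T x‖ ^ 2) := by
          simp only [_root_.smul_apply, inner_smul_right, norm_smul, mul_pow,
            Real.norm_eq_abs, sq_abs]
          ring
        have e3 := mul_le_mul_of_nonneg_left e (hp.1 x)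
        rw [← e2] at e3
        refine le_trans (le_of_eq ?_) e3
        ring
      refine le_trans (le_of_eq ?_) hint
      rw [integral_sub i4 (h6.const_mul _), integral_sub i3 (h4.const_mul _),
        integral_sub i2 (hr.const_mul _), integral_add i1 (hq2.const_mul _),
        integral_add hp.integrable (hq.const_mul _)]
      simp only [integral_const_mul, hp.2.1]
      ring)
    (fun s => by
      have h := hp.integral_mul_integral_le_one hτ (s • T) fun x y => by
        simp only [_root_.smul_apply, inner_smul_left, inner_smul_right, hT,
          RCLike.conj_to_real]
      have e : -(s • T) = (-s) • T := by ext; simp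
      rwa [e] at h)
  rw [div_mul_eq_mul_div, le_div_iff₀ hτ]
  nlinarith [hmain]

end IsMoreLogConcaveThanGauss

end Poincare

section Covariance

open scoped RealInnerProductSpace

theorem matRpow_isHermitian {d : ℕ} (A : Matrix (Fin d) (Fin d) ℝ) (r : ℝ) :
    (matRpow A r).IsHermitian := by
  unfold matRpow
  split_ifs with hA
  · simp [Matrix.IsHermitian, Matrix.star_eq_conjTranspose, Matrix.mul_assoc]
  · exact Matrix.isHermitian_zero

theorem matRpow_neg_half_mul_mul {d : ℕ} {A : Matrix (Fin d) (Fin d) ℝ} (hA : A.PosDef) :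
    matRpow A (-(1 : ℝ) / 2) * A * matRpow A (-(1 : ℝ) / 2) = 1 := by
  have hH := hA.isHermitian
  have hs := hH.spectral_theorem
  rw [Unitary.conjStarAlgAut_apply] at hs
  set U : Matrix (Fin d) (Fin d) ℝ := (hH.eigenvectorUnitary : Matrix (Fin d) (Fin d) ℝ) with hU
  set D := diagonal fun i => hH.eigenvalues i ^ (-(1 : ℝ) / 2)
  set L : Matrix (Fin d) (Fin d) ℝ := diagonal (RCLike.ofReal ∘ hH.eigenvalues)
  have hB : matRpow A (-(1 : ℝ) / 2) = U * D * star U := dif_pos hH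
  have hUU : star U * U = 1 := Unitary.coe_star_mul_self hH.eigenvectorUnitary
  have hUU' : U * star U = 1 := Unitary.coe_mul_star_self hH.eigenvectorUnitary
  have hD : D * L * D = 1 := by
    rw [diagonal_mul_diagonal, diagonal_mul_diagonal, ← diagonal_one]
    congr 1
    funext i
    have hpos := hA.eigenvalues_pos i
    change hH.eigenvalues i ^ (-(1 : ℝ) / 2) * hH.eigenvalues i *
      hH.eigenvalues i ^ (-(1 : ℝ) / 2) = 1
    rw [mul_right_comm, ← Real.rpow_add hpos, show (-(1 : ℝ) / 2 + -1 / 2) = -1 by norm_num,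
      Real.rpow_neg_one, inv_mul_cancel₀ hpos.ne']
  calc matRpow A (-(1 : ℝ) / 2) * A * matRpow A (-(1 : ℝ) / 2)
      = U * D * star U * (U * L * star U) * (U * D * star U) := by rw [hB, ← hs]
    _ = U * (D * (star U * U) * L * (star U * U) * D) * star U := by simp only [Matrix.mul_assoc]
    _ = 1 := by rw [hUU, Matrix.mul_one, Matrix.mul_one, hD, Matrix.mul_one, hUU']

namespace IsMoreLogConcaveThanGauss

variable {d : ℕ} {τ : ℝ} {p : EuclideanSpace ℝ (Fin d) → ℝ}

theorem integrable_mul_coord (hp : IsMoreLogConcaveThanGauss τ p) (hτ : 0 < τ) (i : Fin d) :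
    Integrable fun x => p x * x i :=
  hp.integrable_mul hτ (by fun_prop) 1 1 fun x => by
    simpa using PiLp.norm_apply_le x i

theorem integrable_mul_coord_mul_coord (hp : IsMoreLogConcaveThanGauss τ p) (hτ : 0 < τ)
    (i j : Fin d) : Integrable fun x => p x * (x i * x j) :=
  hp.integrable_mul hτ (by fun_prop) 1 2 fun x => by
    rw [abs_mul, one_mul, sq]
    exact mul_le_mul (PiLp.norm_apply_le x i) (PiLp.norm_apply_le x j) (abs_nonneg _)
      (norm_nonneg _)

theorem integrable_mul_inner_mul_coord_mul_coord (hp : IsMoreLogConcaveThanGauss τ p) (hτ : 0 < τ)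
    (w : EuclideanSpace ℝ (Fin d)) (i j : Fin d) :
    Integrable fun x => p x * (⟪x, w⟫ * (x i * x j)) :=
  hp.integrable_mul hτ (by fun_prop) ‖w‖ 3 fun x => by
    calc |⟪x, w⟫ * (x i * x j)| = |⟪x, w⟫| * (|x i| * |x j|) := by rw [abs_mul, abs_mul]
      _ ≤ (‖x‖ * ‖w‖) * (‖x‖ * ‖x‖) := by
        gcongr
        exacts [abs_real_inner_le_norm _ _, PiLp.norm_apply_le x i, PiLp.norm_apply_le x j]
      _ = ‖w‖ * ‖x‖ ^ 3 := by ring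

theorem integral_mul_coord (hp : IsMoreLogConcaveThanGauss τ p) (hτ : 0 < τ) (i : Fin d) :
    ∫ x, p x * x i = densMean p i := by
  have hint : Integrable fun x => p x • x :=
    (hp.integrable_mul_norm_pow hτ 1).mono'
      (hp.integrable.aestronglyMeasurable.smul aestronglyMeasurable_id) (ae_of_all _ fun x => by
        rw [norm_smul, Real.norm_of_nonneg (hp.1 x), pow_one])
  have h := (EuclideanSpace.proj i : EuclideanSpace ℝ (Fin d) →L[ℝ] ℝ).integral_comp_comm hint
  simpa [densMean] using h

theorem covMatrix_apply (hmean : densMean p = 0) (i j : Fin d) :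
    covMatrix p i j = ∫ x, p x * (x i * x j) := by
  simp [covMatrix, hmean]

theorem dotProduct_mulVec_eq_sum (M : Matrix (Fin d) (Fin d) ℝ) (x : Fin d → ℝ) :
    x ⬝ᵥ M *ᵥ x = ∑ i, ∑ j, M i j * (x i * x j) := by
  simp only [dotProduct, mulVec, Finset.mul_sum]
  exact Finset.sum_congr rfl fun i _ => Finset.sum_congr rfl fun j _ => by ring

/-- Expectation of a quadratic form under a centred density. -/
theorem integral_mul_quadraticForm (hp : IsMoreLogConcaveThanGauss τ p) (hτ : 0 < τ)
    (hmean : densMean p = 0) (M : Matrix (Fin d) (Fin d) ℝ) :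
    ∫ x, p x * (x ⬝ᵥ M *ᵥ x) = trace (covMatrix p * M) := by
  have e : ∀ x : EuclideanSpace ℝ (Fin d),
      p x * (x ⬝ᵥ M *ᵥ x) = ∑ i, ∑ j, M i j * (p x * (x i * x j)) := fun x => by
    rw [dotProduct_mulVec_eq_sum, Finset.mul_sum]
    refine Finset.sum_congr rfl fun i _ => ?_
    rw [Finset.mul_sum]
    exact Finset.sum_congr rfl fun j _ => by ring
  have hi := fun i j => (hp.integrable_mul_coord_mul_coord hτ i j).const_mul (M i j)
  simp only [e]
  rw [integral_finsetSum _ fun i _ => integrable_finsetSum _ fun j _ => hi i j]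
  simp only [integral_finsetSum _ fun j _ => hi _ j, integral_const_mul,
    ← covMatrix_apply hmean, trace, diag_apply, Matrix.mul_apply]
  rw [Finset.sum_comm]
  refine Finset.sum_congr rfl fun i _ => Finset.sum_congr rfl fun j _ => ?_
  rw [mul_comm, covMatrix_apply hmean, covMatrix_apply hmean]
  simp only [mul_comm]

theorem integral_mul_inner_sq (hp : IsMoreLogConcaveThanGauss τ p) (hτ : 0 < τ)
    (hmean : densMean p = 0) (w : EuclideanSpace ℝ (Fin d)) :
    ∫ x, p x * ⟪x, w⟫ ^ 2 = w ⬝ᵥ covMatrix p *ᵥ w := by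
  have e : ∀ x : EuclideanSpace ℝ (Fin d), ⟪x, w⟫ ^ 2 = x ⬝ᵥ vecMulVec w w *ᵥ x := fun x => by
    simp only [vecMulVec_mulVec, EuclideanSpace.inner_eq_star_dotProduct, star_trivial]
    simp [dotProduct_comm, sq]
  simp only [e, hp.integral_mul_quadraticForm hτ hmean]
  rw [mul_vecMulVec, trace_vecMulVec, dotProduct_comm]

theorem integral_mul_inner_const (hp : IsMoreLogConcaveThanGauss τ p) (hτ : 0 < τ)
    (hmean : densMean p = 0) (w : EuclideanSpace ℝ (Fin d)) :
    ∫ x, p x * ⟪x, w⟫ = 0 := by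
  have e : ∀ x : EuclideanSpace ℝ (Fin d), p x * ⟪x, w⟫ = ∑ i, w i * (p x * x i) := fun x => by
    rw [PiLp.inner_apply, Finset.mul_sum]
    exact Finset.sum_congr rfl fun i _ => by simp; ring
  simp only [e]
  rw [integral_finsetSum _ fun i _ => (hp.integrable_mul_coord hτ i).const_mul _]
  simp [integral_const_mul, hp.integral_mul_coord hτ, hmean]

theorem covMatrix_posSemidef (hp : IsMoreLogConcaveThanGauss τ p) (hτ : 0 < τ)
    (hmean : densMean p = 0) : (covMatrix p).PosSemidef := by
  refine .of_dotProduct_mulVec_nonneg ?_ fun w => ?_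
  · ext i j
    simp only [conjTranspose_apply, star_trivial, covMatrix_apply hmean, mul_comm]
  · rw [star_trivial, ← hp.integral_mul_inner_sq hτ hmean (WithLp.toLp 2 w)]
    exact integral_nonneg fun x => mul_nonneg (hp.1 x) (sq_nonneg _)

/-- Correlation with a centred linear statistic of unit variance is controlled by the variance. -/
theorem integral_mul_inner_mul_sq_le (hp : IsMoreLogConcaveThanGauss τ p) (hτ : 0 < τ)
    (hmean : densMean p = 0) (w : EuclideanSpace ℝ (Fin d))
    (hw : w ⬝ᵥ covMatrix p *ᵥ w = 1)
    (T : EuclideanSpace ℝ (Fin d) →L[ℝ] EuclideanSpace ℝ (Fin d)) :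
    (∫ x, p x * (⟪x, w⟫ * ⟪x, T x⟫)) ^ 2 ≤
      (∫ x, p x * ⟪x, T x⟫ ^ 2) - (∫ x, p x * ⟪x, T x⟫) ^ 2 := by
  set m := ∫ x, p x * ⟪x, T x⟫ with hm
  set t := ∫ x, p x * (⟪x, w⟫ * ⟪x, T x⟫) with ht
  have hq := hp.integrable_mul_inner hτ T
  have hq2 := hp.integrable_mul_inner_sq hτ T
  have hl : Integrable fun x => p x * ⟪x, w⟫ := hp.integrable_mul hτ (by fun_prop) ‖w‖ 1 fun x => by
    rw [pow_one, mul_comm]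
    exact abs_real_inner_le_norm _ _
  have hl2 : Integrable fun x => p x * ⟪x, w⟫ ^ 2 :=
    hp.integrable_mul hτ (by fun_prop) (‖w‖ ^ 2) 2 fun x => by
      rw [abs_pow, ← mul_pow, mul_comm]
      gcongr
      exact abs_real_inner_le_norm _ _
  have hlq : Integrable fun x => p x * (⟪x, w⟫ * ⟪x, T x⟫) :=
    hp.integrable_mul hτ (by fun_prop) (‖w‖ * ‖T‖) 3 fun x => by
      calc |⟪x, w⟫ * ⟪x, T x⟫| = |⟪x, w⟫| * |⟪x, T x⟫| := abs_mul _ _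
        _ ≤ (‖x‖ * ‖w‖) * (‖T‖ * ‖x‖ ^ 2) := by
          gcongr
          exacts [abs_real_inner_le_norm _ _, abs_inner_apply_le T x]
        _ = ‖w‖ * ‖T‖ * ‖x‖ ^ 3 := by ring
  have h0 : 0 ≤ ∫ x, p x * (⟪x, T x⟫ - m - t * ⟪x, w⟫) ^ 2 :=
    integral_nonneg fun x => mul_nonneg (hp.1 x) (sq_nonneg _)
  have i1 : Integrable fun x => p x * ⟪x, T x⟫ ^ 2 + m ^ 2 * p x :=
    hq2.add (hp.integrable.const_mul _)
  have i2 : Integrable fun x => p x * ⟪x, T x⟫ ^ 2 + m ^ 2 * p x + t ^ 2 * (p x * ⟪x, w⟫ ^ 2) :=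
    i1.add (hl2.const_mul _)
  have i3 : Integrable fun x => p x * ⟪x, T x⟫ ^ 2 + m ^ 2 * p x + t ^ 2 * (p x * ⟪x, w⟫ ^ 2)
      + 2 * m * t * (p x * ⟪x, w⟫) := i2.add (hl.const_mul _)
  have i4 : Integrable fun x => p x * ⟪x, T x⟫ ^ 2 + m ^ 2 * p x + t ^ 2 * (p x * ⟪x, w⟫ ^ 2)
      + 2 * m * t * (p x * ⟪x, w⟫) - 2 * m * (p x * ⟪x, T x⟫) := i3.sub (hq.const_mul _)
  have e : ∀ x, p x * (⟪x, T x⟫ - m - t * ⟪x, w⟫) ^ 2 =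
      p x * ⟪x, T x⟫ ^ 2 + m ^ 2 * p x + t ^ 2 * (p x * ⟪x, w⟫ ^ 2)
      + 2 * m * t * (p x * ⟪x, w⟫) - 2 * m * (p x * ⟪x, T x⟫)
      - 2 * t * (p x * (⟪x, w⟫ * ⟪x, T x⟫)) := fun x => by ring
  simp only [e] at h0
  rw [integral_sub i4 (hlq.const_mul _), integral_sub i3 (hq.const_mul _),
    integral_add i2 (hl.const_mul _), integral_add i1 (hl2.const_mul _),
    integral_add hq2 (hp.integrable.const_mul _)] at h0
  simp only [integral_const_mul, hp.2.1, hp.integral_mul_inner_sq hτ hmean, hw,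
    hp.integral_mul_inner_const hτ hmean, ← hm, ← ht] at h0
  nlinarith [h0]

end IsMoreLogConcaveThanGauss

end Covariance

/-- bound on `tr(Δ²)` for strongly log-concave densities. -/
theorem trace_delta_sq_bound {d : ℕ} (τ : ℝ) (hτ : 0 < τ)
    (p : EuclideanSpace ℝ (Fin d) → ℝ) (hp : IsMoreLogConcaveThanGauss τ p)
    (hmean : densMean p = 0) (hdet : IsUnit (covMatrix p).det)
    (v : EuclideanSpace ℝ (Fin d)) (hv : ‖v‖ = 1)
    (Δ : Matrix (Fin d) (Fin d) ℝ)
    (hΔ : Δ = Matrix.of fun i j =>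
      ∫ x : EuclideanSpace ℝ (Fin d),
        p x * (((fun k => x k) ⬝ᵥ (matRpow (covMatrix p) (-(1 : ℝ) / 2)).mulVec
          (fun k => v k)) * (x i * x j))) :
    Matrix.trace (Δ * Δ) ≤
      Real.sqrt ((4 / τ) * Matrix.trace (covMatrix p * (Δ * Δ))) := by
  have hA : (covMatrix p).PosDef :=
    (hp.covMatrix_posSemidef hτ hmean).posDef_iff_det_ne_zero.2 hdet.ne_zero
  set B := matRpow (covMatrix p) (-(1 : ℝ) / 2) with hB
  set w : EuclideanSpace ℝ (Fin d) := WithLp.toLp 2 (B *ᵥ v) with hw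
  set T := toEuclideanCLM (𝕜 := ℝ) Δ with hTdef
  have hΔ' : ∀ i j, Δ i j = ∫ x, p x * (inner ℝ x w * (x i * x j)) := fun i j => by
    rw [hΔ]
    refine integral_congr_ae (ae_of_all _ fun x => ?_)
    simp only [EuclideanSpace.inner_eq_star_dotProduct, star_trivial, hw]
    rw [dotProduct_comm (B *ᵥ v)]
  have hΔsymm : Δᵀ = Δ := by
    ext i j
    simp only [transpose_apply, hΔ', mul_comm]
  have hT : ∀ x y, inner ℝ (T x) y = inner ℝ x (T y) := fun x y => by
    rw [real_inner_comm, inner_toEuclideanCLM, inner_toEuclideanCLM, dotProduct_mulVec,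
      ← mulVec_transpose, hΔsymm, dotProduct_comm]
  have hBt : Bᵀ = B := matRpow_isHermitian _ _
  have hw1 : w ⬝ᵥ covMatrix p *ᵥ w = 1 := by
    have hv1 : v ⬝ᵥ v = 1 := by
      have h := real_inner_self_eq_norm_sq v
      rw [hv, EuclideanSpace.inner_eq_star_dotProduct] at h
      simpa using h
    calc (B *ᵥ v) ⬝ᵥ covMatrix p *ᵥ (B *ᵥ v) = v ⬝ᵥ (B * covMatrix p * B) *ᵥ v := by
          rw [← mulVec_mulVec, ← mulVec_mulVec, dotProduct_mulVec v B, ← mulVec_transpose, hBt]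
      _ = 1 := by rw [hB, matRpow_neg_half_mul_mul hA, one_mulVec, hv1]
  have htr : ∫ x, p x * (inner ℝ x w * inner ℝ x (T x)) = trace (Δ * Δ) := by
    have e : ∀ x, p x * (inner ℝ x w * inner ℝ x (T x)) =
        ∑ i, ∑ j, Δ i j * (p x * (inner ℝ x w * (x i * x j))) := fun x => by
      rw [inner_toEuclideanCLM, IsMoreLogConcaveThanGauss.dotProduct_mulVec_eq_sum,
        Finset.mul_sum, Finset.mul_sum]
      refine Finset.sum_congr rfl fun i _ => ?_
      rw [Finset.mul_sum, Finset.mul_sum]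
      exact Finset.sum_congr rfl fun j _ => by ring
    have hi := fun i j =>
      (hp.integrable_mul_inner_mul_coord_mul_coord hτ w i j).const_mul (Δ i j)
    simp only [e]
    rw [integral_finsetSum _ fun i _ => integrable_finsetSum _ fun j _ => hi i j]
    simp only [integral_finsetSum _ fun j _ => hi _ j, integral_const_mul, ← hΔ', trace,
      diag_apply, Matrix.mul_apply]
    refine Finset.sum_congr rfl fun i _ => Finset.sum_congr rfl fun j _ => ?_
    rw [← transpose_apply Δ i j, hΔsymm]
  have hr : ∫ x, p x * ‖T x‖ ^ 2 = trace (covMatrix p * (Δ * Δ)) := by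
    rw [← hp.integral_mul_quadraticForm hτ hmean]
    refine integral_congr_ae (ae_of_all _ fun x => ?_)
    simp only
    rw [← real_inner_self_eq_norm_sq, hT, inner_toEuclideanCLM, ofLp_toEuclideanCLM, mulVec_mulVec]
  rw [← htr, ← hr]
  exact (le_abs_self _).trans (Real.abs_le_sqrt
    ((hp.integral_mul_inner_mul_sq_le hτ hmean w hw1 T).trans (hp.variance_inner_le hτ T hT)))
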